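/- arXiv:2110.07099 — 2 statements merged into one kernel-verified Lean document; each statement's English description precedes it below -/
import Mathlib

section
/- Pointwise trace inverse inequality on [−1,1]: For every natural number k, every real polynomial p with deg p ≤ k, and every x ∈ [−1,1], |p(x)| ≤ (√2/2) · (k+1) · ( ∫_{−1}^{1} p(y)² dy )^{1/2}. -/
open Polynomial

/-- Legendre polynomials, through a derivative recurrence. -/
noncomputable def legP : ℕ → Polynomial ℝ
  | 0 => 1
  | n + 1 => X * legP n + C (1 / ((n : ℝ) + 1)) * ((X * X - 1) * derivative (legP n))

lemma legP_def (n : ℕ) : C ((n : ℝ) + 1) * legP (n + 1) =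
    C ((n : ℝ) + 1) * (X * legP n) + (X * X - 1) * derivative (legP n) := by
  have h : C ((n : ℝ) + 1) * C (1 / ((n : ℝ) + 1)) = 1 := by
    rw [← C_mul, mul_one_div_cancel (by positivity), C_1]
  rw [legP]
  linear_combination ((X * X - 1) * derivative (legP n)) * h

lemma legP_ode (n : ℕ) : derivative ((X * X - 1) * derivative (legP n)) =
      C ((n : ℝ) * (n + 1)) * legP n ∧
    derivative (legP (n + 1)) = X * derivative (legP n) + C ((n : ℝ) + 1) * legP n := by
  have key : ∀ n, derivative ((X * X - 1) * derivative (legP n)) =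
      C ((n : ℝ) * (n + 1)) * legP n →
      derivative (legP (n + 1)) = X * derivative (legP n) + C ((n : ℝ) + 1) * legP n := by
    intro n h
    have h0 : (C ((n : ℝ) + 1)) ≠ 0 := by
      rw [Ne, C_eq_zero]; positivity
    have h1 := congrArg derivative (legP_def n)
    rw [derivative_add, h] at h1
    simp only [derivative_mul, derivative_C, derivative_X] at h1
    apply mul_left_cancel₀ h0
    simp only [C_add, C_mul, C_1] at h1 ⊢
    linear_combination h1
  have main : derivative ((X * X - 1) * derivative (legP n)) =
      C ((n : ℝ) * (n + 1)) * legP n := by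
    induction n with
    | zero => simp [legP]
    | succ n ih =>
      have hA := key n ih
      have hd := legP_def n
      have e : (X * X - 1) * derivative (legP (n + 1)) =
          C ((n : ℝ) + 1) * (X * legP (n + 1) - legP n) := by
        rw [hA]; linear_combination (-X) * hd
      rw [e]
      simp only [derivative_mul, derivative_C, derivative_X, derivative_sub]
      rw [hA]
      push_cast
      simp only [C_add, C_mul, C_1] at hd ⊢
      linear_combination (-(C (n : ℝ)) - 1) * hd
  exact ⟨main, key n main⟩

lemma legP_B (n : ℕ) : X * derivative (legP (n + 1)) - derivative (legP n) =
    C ((n : ℝ) + 1) * legP (n + 1) := by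
  rw [(legP_ode n).2]; linear_combination - legP_def n

lemma legP_bound (n : ℕ) (x : ℝ) (hx : x ∈ Set.Icc (-1 : ℝ) 1) :
    (legP n).eval x ^ 2 ≤ 1 := by
  have hs : 0 ≤ 1 - x ^ 2 := by nlinarith [hx.1, hx.2]
  have main : ∀ n : ℕ, ((n : ℝ) + 1) ^ 2 * (legP (n + 1)).eval x ^ 2 +
      (1 - x ^ 2) * (derivative (legP (n + 1))).eval x ^ 2 ≤ ((n : ℝ) + 1) ^ 2 := by
    intro n
    induction n with
    | zero => simp [legP]
    | succ n ih =>
      have h1 := congrArg (eval x) (legP_def (n + 1))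
      have h2 := congrArg (eval x) (legP_ode (n + 1)).2
      simp only [eval_add, eval_mul, eval_C, eval_X, eval_sub, eval_one] at h1 h2
      push_cast at h1 h2 ⊢
      rw [← mul_pow, h1, h2]
      set u := (legP (n + 1)).eval x
      set w := (derivative (legP (n + 1))).eval x
      have hu : ((n : ℝ) + 1) ^ 2 * u ^ 2 ≤ ((n : ℝ) + 1) ^ 2 * 1 := by
        have := mul_nonneg hs (sq_nonneg w)
        linarith
      have hu1 : u ^ 2 ≤ 1 := le_of_mul_le_mul_left hu (by positivity)
      have hn : (0 : ℝ) ≤ n := n.cast_nonneg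
      nlinarith
  cases n with
  | zero => simp [legP]
  | succ n =>
    have := main n
    have h2 := mul_nonneg hs (sq_nonneg ((derivative (legP (n + 1))).eval x))
    have hu : ((n : ℝ) + 1) ^ 2 * (legP (n + 1)).eval x ^ 2 ≤ ((n : ℝ) + 1) ^ 2 * 1 := by
      linarith
    exact le_of_mul_le_mul_left hu (by positivity)

lemma legP_one (n : ℕ) : (legP n).eval 1 = 1 := by
  induction n with
  | zero => simp [legP]
  | succ n ih => simp [legP, ih]

lemma legP_neg_one (n : ℕ) : (legP n).eval (-1) = (-1) ^ n := by
  induction n with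
  | zero => simp [legP]
  | succ n ih => simp [legP, ih, pow_succ]

/-- The integral over `[-1,1]` as a linear functional on polynomials. -/
noncomputable def polyI : Polynomial ℝ →ₗ[ℝ] ℝ where
  toFun p := ∫ y in (-1:ℝ)..1, p.eval y
  map_add' p q := by
    simp only [eval_add]
    exact intervalIntegral.integral_add (p.continuous.intervalIntegrable _ _)
      (q.continuous.intervalIntegrable _ _)
  map_smul' c p := by
    simp

lemma polyI_derivative (p : Polynomial ℝ) :
    polyI (derivative p) = p.eval 1 - p.eval (-1) := by
  change (∫ y in (-1:ℝ)..1, (derivative p).eval y) = _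
  exact intervalIntegral.integral_eq_sub_of_hasDerivAt (fun x _ => p.hasDerivAt x)
    ((derivative p).continuous.intervalIntegrable _ _)

lemma polyI_C_mul (c : ℝ) (p : Polynomial ℝ) : polyI (C c * p) = c * polyI p := by
  rw [← smul_eq_C_mul, map_smul, smul_eq_mul]

lemma legP_orth (m n : ℕ) (h : m < n) : polyI (legP m * legP n) = 0 := by
  have e : derivative (((X * X - 1) * derivative (legP n)) * legP m
      - ((X * X - 1) * derivative (legP m)) * legP n) =
      C ((n : ℝ) * (n + 1) - m * (m + 1)) * (legP m * legP n) := by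
    rw [derivative_sub, derivative_mul, derivative_mul (g := legP n), (legP_ode n).1,
      (legP_ode m).1, C_sub]
    ring
  have h1 := polyI_derivative (((X * X - 1) * derivative (legP n)) * legP m
      - ((X * X - 1) * derivative (legP m)) * legP n)
  rw [e, polyI_C_mul] at h1
  simp at h1
  rcases h1 with h1 | h1
  · exfalso
    have : (m : ℝ) < n := by exact_mod_cast h
    have hm : (0 : ℝ) ≤ m := m.cast_nonneg
    nlinarith
  · exact h1

lemma legP_norm (n : ℕ) : (2 * (n : ℝ) + 1) * polyI (legP n * legP n) = 2 := by
  induction n with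
  | zero =>
    have := polyI_derivative (X : Polynomial ℝ)
    simp at this
    simp [legP, this]; norm_num
  | succ n ih =>
    have e : derivative (X * (legP (n + 1) * legP (n + 1) + legP n * legP n)
        - 2 * (legP n * legP (n + 1))) =
        C (2 * (n : ℝ) + 3) * (legP (n + 1) * legP (n + 1))
          - C (2 * (n : ℝ) + 1) * (legP n * legP n) := by
      have hB := legP_B n
      have hA := (legP_ode n).2
      have h2 : (C (2 : ℝ)) = 2 := rfl
      have h3 : (C (3 : ℝ)) = 3 := rfl
      simp only [derivative_mul, derivative_sub, derivative_add, derivative_X, derivative_ofNat,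
        C_add, C_mul, C_1, h2, h3] at hA hB ⊢
      linear_combination (2 * legP (n + 1)) * hB - (2 * legP n) * hA
    have h1 := polyI_derivative (X * (legP (n + 1) * legP (n + 1) + legP n * legP n)
        - 2 * (legP n * legP (n + 1)))
    rw [e, map_sub, polyI_C_mul, polyI_C_mul] at h1
    simp only [eval_sub, eval_mul, eval_add, eval_X, legP_one, legP_neg_one, eval_ofNat] at h1
    have h4 : ((-1 : ℝ) ^ n) * (-1) ^ n = 1 := by rw [← mul_pow]; simp
    rw [pow_succ] at h1
    push_cast
    linear_combination h1 + ih - 4 * h4 + 4 * h4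

lemma coeff_X_mul_deriv_aux (p : Polynomial ℝ) (m : ℕ) :
    (X * derivative p).coeff m = m * p.coeff m := by
  cases m with
  | zero => simp
  | succ m => rw [coeff_X_mul, coeff_derivative]; push_cast; ring

lemma legP_coeff_succ (n m : ℕ) : ((n : ℝ) + 1) * (legP (n + 1)).coeff (m + 1) =
    ((n : ℝ) + 1 + m) * (legP n).coeff m - (m + 2) * (legP n).coeff (m + 2) := by
  have h := congrArg (fun q => coeff q (m + 1)) (legP_def n)
  simp only [sub_mul, mul_assoc, one_mul, coeff_add, coeff_sub, coeff_C_mul, coeff_X_mul,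
    coeff_X_mul_deriv_aux, coeff_derivative] at h
  rw [h]; push_cast; ring

lemma legP_coeff_high (n : ℕ) : ∀ m, n < m → (legP n).coeff m = 0 := by
  induction n with
  | zero => intro m hm; simp [legP, coeff_one]; omega
  | succ n ih =>
    intro m hm
    obtain ⟨m, rfl⟩ : ∃ m', m = m' + 1 := ⟨m - 1, by omega⟩
    have h := legP_coeff_succ n m
    rw [ih m (by omega), ih (m + 2) (by omega)] at h
    have h0 : ((n : ℝ) + 1) ≠ 0 := by positivity
    simpa [h0] using h

lemma legP_coeff_lead (n : ℕ) : 0 < (legP n).coeff n := by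
  induction n with
  | zero => simp [legP]
  | succ n ih =>
    have h := legP_coeff_succ n n
    rw [legP_coeff_high n (n + 2) (by omega)] at h
    have h1 : 0 < ((n : ℝ) + 1) * (legP (n + 1)).coeff (n + 1) := by
      rw [h, mul_zero, sub_zero]; positivity
    exact pos_of_mul_pos_right h1 (by positivity)

lemma legP_split (k : ℕ) (p : Polynomial ℝ) (hp : p.natDegree ≤ k + 1) :
    ∃ (q : Polynomial ℝ) (c : ℝ), q.natDegree ≤ k ∧ p = q + C c * legP (k + 1) := by
  have hl := legP_coeff_lead (k + 1)
  refine ⟨p - C (p.coeff (k + 1) / (legP (k + 1)).coeff (k + 1)) * legP (k + 1),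
    p.coeff (k + 1) / (legP (k + 1)).coeff (k + 1), ?_, by ring⟩
  rw [natDegree_le_iff_coeff_eq_zero]
  intro N hN
  rw [coeff_sub, coeff_C_mul]
  rcases eq_or_ne N (k + 1) with rfl | h
  · field_simp; simp
  · rw [legP_coeff_high _ N (by omega), coeff_eq_zero_of_natDegree_lt (by omega)]; simp

lemma legP_const (p : Polynomial ℝ) (hp : p.natDegree ≤ 0) : ∃ c : ℝ, p = C c * legP 0 :=
  ⟨p.coeff 0, by rw [legP, mul_one]; exact eq_C_of_natDegree_le_zero hp⟩

lemma legP_orth_lower (k m : ℕ) (hm : k < m) (p : Polynomial ℝ) (hp : p.natDegree ≤ k) :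
    polyI (p * legP m) = 0 := by
  induction k generalizing p with
  | zero =>
    obtain ⟨c, rfl⟩ := legP_const p hp
    rw [mul_assoc, polyI_C_mul, legP_orth 0 m hm, mul_zero]
  | succ k ih =>
    obtain ⟨q, c, hq, rfl⟩ := legP_split k p hp
    rw [add_mul, map_add, ih (by omega) q hq, mul_assoc, polyI_C_mul, legP_orth _ m hm]
    simp

lemma legP_main (k : ℕ) (p : Polynomial ℝ) (hp : p.natDegree ≤ k) (x : ℝ)
    (hx : x ∈ Set.Icc (-1 : ℝ) 1) :
    2 * p.eval x ^ 2 ≤ ((k : ℝ) + 1) ^ 2 * polyI (p * p) := by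
  induction k generalizing p with
  | zero =>
    obtain ⟨c, rfl⟩ := legP_const p hp
    have h := legP_norm 0
    have e : C c * legP 0 * (C c * legP 0) = C (c * c) * (legP 0 * legP 0) := by
      rw [C_mul]; ring
    rw [e, polyI_C_mul]
    simp only [Nat.cast_zero] at h ⊢
    have h' : polyI (legP 0 * legP 0) = 2 := by linarith
    rw [h']
    simp [legP]
    nlinarith
  | succ k ih =>
    obtain ⟨q, c, hq, rfl⟩ := legP_split k p hp
    have h := legP_norm (k + 1)
    have ho := legP_orth_lower k (k + 1) (by omega) q hq
    have hb := legP_bound (k + 1) x hx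
    have e : (q + C c * legP (k + 1)) * (q + C c * legP (k + 1)) =
        q * q + C (2 * c) * (q * legP (k + 1)) + C (c * c) * (legP (k + 1) * legP (k + 1)) := by
      have h2 : (C (2 : ℝ)) = 2 := rfl
      rw [C_mul, C_mul, h2]; ring
    rw [e, map_add, map_add, polyI_C_mul, polyI_C_mul, ho]
    have hi := ih q hq
    simp only [eval_add, eval_mul, eval_C]
    push_cast at h ⊢
    set u := (legP (k + 1)).eval x
    set v := q.eval x
    set Q := polyI (q * q)
    set N := polyI (legP (k + 1) * legP (k + 1))
    have hk : (0 : ℝ) ≤ k := k.cast_nonneg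
    generalize (k : ℝ) = t at *
    have ha : 0 < t + 1 := by linarith
    have hbp : 0 < 2 * t + 3 := by linarith
    have hN : N = 2 / (2 * t + 3) := by
      rw [eq_div_iff hbp.ne']; linarith
    have hQ : 2 * v ^ 2 / (t + 1) ^ 2 ≤ Q := by
      rw [div_le_iff₀ (by positivity)]; linarith
    have hcu : c ^ 2 * u ^ 2 ≤ c ^ 2 := by nlinarith [sq_nonneg c]
    calc 2 * (v + c * u) ^ 2
        ≤ (t + 1 + 1) ^ 2 * (2 * v ^ 2 / (t + 1) ^ 2 + c ^ 2 * u ^ 2 * (2 / (2 * t + 3))) := by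
          have : (t + 1 + 1) ^ 2 * (2 * v ^ 2 / (t + 1) ^ 2 + c ^ 2 * u ^ 2 * (2 / (2 * t + 3)))
            - 2 * (v + c * u) ^ 2 =
            2 * ((2 * t + 3) * v - (t + 1) ^ 2 * (c * u)) ^ 2 / ((t + 1) ^ 2 * (2 * t + 3)) := by
            field_simp; ring
          have h2 : 0 ≤ 2 * ((2 * t + 3) * v - (t + 1) ^ 2 * (c * u)) ^ 2 /
            ((t + 1) ^ 2 * (2 * t + 3)) := by positivity
          linarith
      _ ≤ (t + 1 + 1) ^ 2 * (Q + c ^ 2 * (2 / (2 * t + 3))) := by gcongr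
      _ = _ := by rw [hN]; ring

/-- Pointwise trace inverse inequality on `[-1,1]`:
`|p(x)| ≤ (√2/2)(k+1) ‖p‖_{L²(-1,1)}` for polynomials of degree at most `k`. -/
theorem pointwise_trace_inverse_inequality (k : ℕ) (p : Polynomial ℝ)
    (hp : p.natDegree ≤ k) (x : ℝ) (hx : x ∈ Set.Icc (-1:ℝ) 1) :
    |p.eval x| ≤
      Real.sqrt 2 / 2 * ((k : ℝ) + 1) * Real.sqrt (∫ y in (-1:ℝ)..1, p.eval y ^ 2) := by
  have h := legP_main k p hp x hx
  have e : polyI (p * p) = ∫ y in (-1:ℝ)..1, p.eval y ^ 2 := by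
    change (∫ y in (-1:ℝ)..1, (p * p).eval y) = _
    simp only [eval_mul, sq]
  rw [e] at h
  have hI : 0 ≤ ∫ y in (-1:ℝ)..1, p.eval y ^ 2 :=
    intervalIntegral.integral_nonneg (by norm_num) (fun _ _ => sq_nonneg _)
  apply abs_le_of_sq_le_sq _ (by positivity)
  rw [mul_pow, mul_pow, div_pow, Real.sq_sqrt (by norm_num), Real.sq_sqrt hI]
  linarith
end

section
/- Half-interval L² derivative inverse inequality with linear degree dependence: For every natural number k and every real polynomial p with deg p ≤ k, ( ∫_{−1/2}^{1/2} p′(x)² dx )^{1/2} ≤ ((4√3+2)/3) · k · ( ∫_{−1}^{1} p(x)² dx )^{1/2}. -/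
open Polynomial

/-- The Legendre operator `p ↦ -((1 - x²) p')'`. -/
noncomputable def legOp (q : Polynomial ℝ) : Polynomial ℝ :=
  -derivative ((1 - X ^ 2) * derivative q)

lemma legOp_sub (p q : Polynomial ℝ) : legOp (p - q) = legOp p - legOp q := by
  simp only [legOp, derivative_sub, mul_sub]; ring

lemma legOp_add (p q : Polynomial ℝ) : legOp (p + q) = legOp p + legOp q := by
  simp only [legOp, derivative_add, mul_add]; ring

lemma legOp_coeff (q : Polynomial ℝ) (n : ℕ) :
    (legOp q).coeff n = n * (n + 1) * q.coeff n - (n + 1) * (n + 2) * q.coeff (n + 2) := by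
  have h : (1 - X ^ 2) * derivative q = derivative q - derivative q * X ^ 2 := by ring
  rw [legOp, h, coeff_neg, coeff_derivative, coeff_sub, coeff_derivative]
  rcases n with _ | n
  · simp [coeff_mul_X_pow']
    ring
  · rw [show n + 1 + 1 = n + 2 by ring, coeff_mul_X_pow, coeff_derivative]
    push_cast
    ring_nf

lemma legOp_solve (k : ℕ) : ∀ j ≤ k, ∀ r : Polynomial ℝ, (∀ n ≥ j, r.coeff n = 0) →
    ∃ q : Polynomial ℝ, (∀ n ≥ j, q.coeff n = 0) ∧ legOp q = C ((k : ℝ) * (k + 1)) * q + r := by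
  intro j
  induction j with
  | zero =>
    intro _ r hr
    have : r = 0 := by ext n; simpa using hr n (Nat.zero_le _)
    exact ⟨0, by simp, by simp [this, legOp]⟩
  | succ j ih =>
    intro hj r hr
    have hne : ((j : ℝ) * (j + 1) - k * (k + 1)) ≠ 0 := by
      have h1 : (j : ℝ) < k := by exact_mod_cast hj
      have h2 : (0 : ℝ) ≤ j := by positivity
      nlinarith
    set s : ℝ := r.coeff j / ((j : ℝ) * (j + 1) - k * (k + 1)) with hs
    have hs' : s * ((j : ℝ) * (j + 1) - k * (k + 1)) = r.coeff j := div_mul_cancel₀ _ hne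
    obtain ⟨q, hq, hL⟩ := ih (by omega)
      (r - (legOp (C s * X ^ j) - C ((k : ℝ) * (k + 1)) * (C s * X ^ j))) (by
        intro n hn
        simp only [coeff_sub, legOp_coeff, coeff_C_mul, coeff_X_pow]
        rcases hn.eq_or_lt with h | h
        · subst h
          simp
          linarith
        · rw [hr n h]
          simp [show n ≠ j by omega, show n + 2 ≠ j by omega])
    refine ⟨q + C s * X ^ j, ?_, ?_⟩
    · intro n hn
      simp [hq n (by omega), show n ≠ j by omega]
    · rw [legOp_add, hL]; ring

lemma legOp_eigen (k : ℕ) : ∃ P : Polynomial ℝ, P.coeff k = 1 ∧ (∀ n > k, P.coeff n = 0) ∧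
    legOp P = C ((k : ℝ) * (k + 1)) * P := by
  obtain ⟨q, hq, hL⟩ := legOp_solve k k le_rfl
    (legOp (X ^ k) - C ((k : ℝ) * (k + 1)) * X ^ k) (by
      intro n hn
      simp only [coeff_sub, legOp_coeff, coeff_C_mul, coeff_X_pow]
      rcases hn.eq_or_lt with h | h
      · subst h
        simp
      · simp [show n ≠ k by omega, show n + 2 ≠ k by omega])
  refine ⟨X ^ k - q, ?_, ?_, ?_⟩
  · simp [hq k le_rfl]
  · intro n hn
    simp [hq n hn.le, coeff_X_pow, hn.ne']
  · rw [legOp_sub, hL]; ring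

lemma poly_ii (p : Polynomial ℝ) (a b : ℝ) :
    IntervalIntegrable (fun x => p.eval x) MeasureTheory.volume a b :=
  p.continuous.intervalIntegrable a b

/-- Integral over `[-1,1]` as a functional on polynomials. -/
noncomputable def pInt (p : Polynomial ℝ) : ℝ := ∫ x in (-1 : ℝ)..1, p.eval x

lemma pInt_add (p q : Polynomial ℝ) : pInt (p + q) = pInt p + pInt q := by
  simp only [pInt, eval_add]
  exact intervalIntegral.integral_add (poly_ii p _ _) (poly_ii q _ _)

lemma pInt_C_mul (c : ℝ) (p : Polynomial ℝ) : pInt (C c * p) = c * pInt p := by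
  simp [pInt]

lemma pInt_sq_nonneg (p : Polynomial ℝ) : 0 ≤ pInt (p ^ 2) := by
  apply intervalIntegral.integral_nonneg (by norm_num)
  intro x _
  rw [eval_pow]; positivity

lemma pInt_parts (p q : Polynomial ℝ) :
    pInt ((1 - X ^ 2) * derivative p * derivative q) = pInt (p * legOp q) := by
  have h : pInt (derivative (p * ((1 - X ^ 2) * derivative q))) = 0 := by
    rw [pInt, intervalIntegral.integral_eq_sub_of_hasDerivAt
      (fun x _ => Polynomial.hasDerivAt _ x) (poly_ii _ _ _)]
    simp
  have e : (1 - X ^ 2) * derivative p * derivative q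
      = derivative (p * ((1 - X ^ 2) * derivative q)) + p * legOp q := by
    rw [derivative_mul, legOp]; ring
  rw [e, pInt_add, h, zero_add]

lemma legendre_ineq (k : ℕ) : ∀ p : Polynomial ℝ, p.natDegree ≤ k →
    pInt ((1 - X ^ 2) * derivative p * derivative p) ≤ (k : ℝ) * (k + 1) * pInt (p ^ 2) := by
  induction k with
  | zero =>
    intro p hp
    rw [natDegree_eq_zero.1 (Nat.le_zero.1 hp) |>.choose_spec.symm]
    simp [pInt]
  | succ k ih =>
    intro p hp
    obtain ⟨P, h1, h2, h3⟩ := legOp_eigen (k + 1)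
    set c := p.coeff (k + 1)
    set r := p - C c * P with hr
    have hrd : r.natDegree ≤ k := by
      rw [natDegree_le_iff_coeff_eq_zero]
      intro n hn
      rw [hr, coeff_sub, coeff_C_mul]
      rcases (Nat.succ_le_of_lt hn).eq_or_lt with h | h
      · rw [← h, Nat.succ_eq_add_one, h1]; ring
      · rw [h2 n h, coeff_eq_zero_of_natDegree_lt (by omega)]; ring
    have hpe : p = r + C c * P := by rw [hr]; ring
    have hI := ih r hrd
    set l : ℝ := ((k + 1 : ℕ) : ℝ) * (((k + 1 : ℕ) : ℝ) + 1) with hl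
    have e1 : pInt ((1 - X ^ 2) * derivative r * derivative P) = l * pInt (r * P) := by
      rw [pInt_parts, h3, ← pInt_C_mul]; congr 1; ring
    have e2 : pInt ((1 - X ^ 2) * derivative P * derivative P) = l * pInt (P ^ 2) := by
      rw [pInt_parts, h3, ← pInt_C_mul]; congr 1; ring
    have d1 : (1 - X ^ 2) * derivative p * derivative p
        = (1 - X ^ 2) * derivative r * derivative r
          + (C (2 * c) * ((1 - X ^ 2) * derivative r * derivative P)
          + C (c ^ 2) * ((1 - X ^ 2) * derivative P * derivative P)) := by
      rw [hpe]; simp only [derivative_add, derivative_C_mul, C_mul, C_pow, C_ofNat]; ring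
    have d2 : p ^ 2 = r ^ 2 + (C (2 * c) * (r * P) + C (c ^ 2) * P ^ 2) := by
      rw [hpe]; simp only [C_mul, C_pow, C_ofNat]; ring
    rw [d1, d2]
    simp only [pInt_add, pInt_C_mul]
    rw [e1, e2]
    have hll : (k : ℝ) * (k + 1) ≤ l := by
      rw [hl]; push_cast; nlinarith [(Nat.cast_nonneg k : (0 : ℝ) ≤ k)]
    have := mul_le_mul_of_nonneg_right hll (pInt_sq_nonneg r)
    nlinarith

lemma half_le (p : Polynomial ℝ) :
    (∫ x in (-(1:ℝ)/2)..(1/2), (derivative p).eval x ^ 2) ≤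
      4 / 3 * pInt ((1 - X ^ 2) * derivative p * derivative p) := by
  rw [← pInt_C_mul, pInt]
  set g := C (4 / 3 : ℝ) * ((1 - X ^ 2) * derivative p * derivative p) with hg
  have hge : ∀ x, g.eval x = 4 / 3 * (1 - x ^ 2) * (derivative p).eval x ^ 2 := by
    intro x; simp [hg]; ring
  calc _ ≤ ∫ x in (-(1:ℝ)/2)..(1/2), g.eval x := by
        apply intervalIntegral.integral_mono_on (by norm_num)
        · exact ((derivative p).continuous.pow 2).intervalIntegrable _ _
        · exact poly_ii _ _ _
        · intro x hx
          rw [hge]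
          have : 1 ≤ 4 / 3 * (1 - x ^ 2) := by nlinarith [hx.1, hx.2]
          nlinarith [sq_nonneg ((derivative p).eval x)]
    _ ≤ _ := by
        apply intervalIntegral.integral_mono_interval (by norm_num) (by norm_num) (by norm_num)
        · rw [Filter.EventuallyLE, MeasureTheory.ae_restrict_iff' measurableSet_Ioc]
          refine Filter.Eventually.of_forall fun x hx => ?_
          simp only [Pi.zero_apply]
          rw [hge]
          have : 0 ≤ 1 - x ^ 2 := by nlinarith [hx.1, hx.2]
          positivity
        · exact poly_ii _ _ _

/-- Half-interval L² derivative inverse inequality with linear degree dependence: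
`‖p'‖_{L²(-1/2,1/2)} ≤ ((4√3+2)/3) k ‖p‖_{L²(-1,1)}` for polynomials of degree at
most `k`. -/
theorem half_interval_derivative_inverse_inequality (k : ℕ) (p : Polynomial ℝ)
    (hp : p.natDegree ≤ k) :
    Real.sqrt (∫ x in (-(1:ℝ)/2)..(1/2), (derivative p).eval x ^ 2) ≤
      (4 * Real.sqrt 3 + 2) / 3 * (k : ℝ)
        * Real.sqrt (∫ x in (-1:ℝ)..1, p.eval x ^ 2) := by
  have h1 := half_le p
  have h2 := legendre_ineq k p hp
  have e : pInt (p ^ 2) = ∫ x in (-1:ℝ)..1, p.eval x ^ 2 := by simp [pInt]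
  have h0 := pInt_sq_nonneg p
  rw [← e]
  have hk : (k : ℝ) * (k + 1) ≤ 2 * k ^ 2 := by
    rcases Nat.eq_zero_or_pos k with h | h
    · simp [h]
    · have : (1 : ℝ) ≤ k := by exact_mod_cast h
      nlinarith
  have hs : (2 : ℝ) ≤ (4 * Real.sqrt 3 + 2) / 3 := by
    have : (1 : ℝ) ≤ Real.sqrt 3 := Real.one_le_sqrt.2 (by norm_num)
    linarith
  calc _ ≤ Real.sqrt ((2 * k) ^ 2 * pInt (p ^ 2)) := by
        apply Real.sqrt_le_sqrt
        have := mul_le_mul_of_nonneg_right hk h0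
        have : 0 ≤ (k : ℝ) ^ 2 * pInt (p ^ 2) := by positivity
        nlinarith
    _ = 2 * k * Real.sqrt (pInt (p ^ 2)) := by
        rw [Real.sqrt_mul (by positivity), Real.sqrt_sq (by positivity)]
    _ ≤ _ := by gcongr
end
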